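/- Assume m = 1 and V ∈ C²(𝕋^d). Then there exists κ > 0 such that for every test function h on X = 𝕋^d × ℝ^d × ℝ^d, ∫_X (|∇_z h|² + |∇_p h|² + |∇_z h − ∇_q h|²) dμ_β ≥ κ ∫_X (h − ∫_X h dμ_β)² dμ_β. In other words, the operator P = A*A + C*C + C₂*C₂ is κ-coercive on the orthogonal complement of the constants in L²(μ_β). -/

import Mathlib

open MeasureTheory Real Filter

noncomputable section

/-- The state space `X = 𝕋^d × ℝ^d × ℝ^{dm}`, realised as
`ℝ^d × ℝ^d × (ℝ^d)^m` with functions that are `ℤ^d`-periodic in the first variable. -/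
abbrev Xsp (d m : ℕ) := (Fin d → ℝ) × (Fin d → ℝ) × (Fin m → Fin d → ℝ)

/-- The direction in the `z_j`-block given by the vector `v`. -/
def zdir (d m : ℕ) (j : Fin m) (v : Fin d → ℝ) : Xsp d m :=
  (0, 0, Function.update 0 j v)

/-- The partial derivative `∂_{z_{j,k}} φ`. -/
def pZ (d m : ℕ) (j : Fin m) (k : Fin d) (φ : Xsp d m → ℝ) (x : Xsp d m) : ℝ :=
  fderiv ℝ φ x (zdir d m j (Pi.single k 1))

/-- The partial derivative `∂_{p_k} φ`. -/
def pP (d m : ℕ) (k : Fin d) (φ : Xsp d m → ℝ) (x : Xsp d m) : ℝ :=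
  fderiv ℝ φ x (0, Pi.single k 1, 0)

/-- The partial derivative `∂_{q_k} φ`. -/
def pQ (d m : ℕ) (k : Fin d) (φ : Xsp d m → ℝ) (x : Xsp d m) : ℝ :=
  fderiv ℝ φ x (Pi.single k 1, 0, 0)

/-- The operator `𝓛` (negative of the generator of the Markovian GLE dynamics):
`𝓛φ = −p·∇_qφ + ∇V·∇_pφ − Σ_j λ_j z_j·∇_pφ + Σ_j λ_j p·∇_{z_j}φ
      + Σ_j α_j z_j·∇_{z_j}φ − β⁻¹ Σ_j α_j Δ_{z_j}φ`. -/
def gen (d m : ℕ) (β : ℝ) (α lam : Fin m → ℝ) (V : (Fin d → ℝ) → ℝ)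
    (φ : Xsp d m → ℝ) (x : Xsp d m) : ℝ :=
  - fderiv ℝ φ x (x.2.1, 0, 0)
  + fderiv ℝ φ x (0, (fun i => fderiv ℝ V x.1 (Pi.single i 1)), 0)
  - fderiv ℝ φ x (0, ∑ j, lam j • x.2.2 j, 0)
  + ∑ j, lam j * fderiv ℝ φ x (zdir d m j x.2.1)
  + ∑ j, α j * fderiv ℝ φ x (zdir d m j (x.2.2 j))
  - β⁻¹ * ∑ j, α j * ∑ k, fderiv ℝ (pZ d m j k φ) x (zdir d m j (Pi.single k 1))

/-- The (unnormalised) Gibbs density `exp(−β(V(q) + |p|²/2 + |z|²/2))`. -/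
def gdens (d m : ℕ) (β : ℝ) (V : (Fin d → ℝ) → ℝ) (x : Xsp d m) : ℝ :=
  Real.exp (-β * (V x.1 + (∑ i, (x.2.1 i) ^ 2) / 2 + (∑ j, ∑ i, (x.2.2 j i) ^ 2) / 2))

/-- The fundamental domain `[0,1)^d` for the torus in the `q`-variable. -/
def cube (d : ℕ) : Set (Fin d → ℝ) := {q | ∀ i, q i ∈ Set.Ico (0 : ℝ) 1}

/-- Lebesgue measure on `X = 𝕋^d × ℝ^d × ℝ^{dm}` (the `q`-variable being
restricted to a fundamental domain of the torus). -/
def volX (d m : ℕ) : Measure (Xsp d m) :=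
  (volume : Measure (Xsp d m)).restrict {x | x.1 ∈ cube d}

/-- The Gibbs measure `μ_β`, with density `Z⁻¹ exp(−β(V(q)+|p|²/2+|z|²/2))`. -/
def gibbs (d m : ℕ) (β Z : ℝ) (V : (Fin d → ℝ) → ℝ) : Measure (Xsp d m) :=
  (volX d m).withDensity fun x => ENNReal.ofReal (Z⁻¹ * gdens d m β V x)

/-- `ℤ^d`-periodicity in the `q`-variable. -/
def PerQ (d m : ℕ) (φ : Xsp d m → ℝ) : Prop :=
  ∀ (k : Fin d → ℤ) (x : Xsp d m), φ (x.1 + (fun i => (k i : ℝ)), x.2) = φ x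

/-- `ℤ^d`-periodicity of the potential. -/
def PerV (d : ℕ) (V : (Fin d → ℝ) → ℝ) : Prop :=
  ∀ (k : Fin d → ℤ) (q : Fin d → ℝ), V (q + fun i => (k i : ℝ)) = V q

/-- A test function: smooth, periodic in `q`, compactly supported in `(p,z)`. -/
def IsTest (d m : ℕ) (φ : Xsp d m → ℝ) : Prop :=
  ContDiff ℝ (⊤ : ℕ∞) φ ∧ PerQ d m φ ∧
    ∃ K : Set ((Fin d → ℝ) × (Fin m → Fin d → ℝ)),
      IsCompact K ∧ ∀ x : Xsp d m, x.2 ∉ K → φ x = 0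

lemma sq_intervalIntegral_le {a b : ℝ} (hab : a ≤ b) {u : ℝ → ℝ} (hu : Continuous u) :
    (∫ t in a..b, u t) ^ 2 ≤ (b - a) * ∫ t in a..b, (u t) ^ 2 := by
  rcases hab.eq_or_lt with rfl | hlt
  · simp
  set I := ∫ t in a..b, u t with hI
  set S := ∫ t in a..b, (u t) ^ 2 with hS
  have h0 : 0 ≤ ∫ t in a..b, ((b - a) * u t - I) ^ 2 :=
    intervalIntegral.integral_nonneg hab fun t _ => sq_nonneg _
  have hexp : ∫ t in a..b, ((b - a) * u t - I) ^ 2 = (b - a) * ((b - a) * S - I ^ 2) := by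
    have : ∀ t, ((b - a) * u t - I) ^ 2
        = ((b - a) ^ 2 * (u t) ^ 2 - 2 * (b - a) * I * u t) + I ^ 2 := fun t => by ring
    simp_rw [this]
    rw [intervalIntegral.integral_add, intervalIntegral.integral_sub,
      intervalIntegral.integral_const_mul, intervalIntegral.integral_const_mul,
      intervalIntegral.integral_const, ← hI, ← hS, smul_eq_mul]
    · ring
    all_goals exact Continuous.intervalIntegrable (by fun_prop) _ _
  rw [hexp] at h0
  have := nonneg_of_mul_nonneg_right h0 (sub_pos.2 hlt)
  linarith

lemma ofReal_sq_sub_le_lintegral {a b : ℝ} (hab : a ≤ b) {F F' : ℝ → ℝ}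
    (hF : ∀ t, HasDerivAt F (F' t) t) (hF' : Continuous F') :
    ENNReal.ofReal ((F b - F a) ^ 2)
      ≤ ENNReal.ofReal (b - a) * ∫⁻ t in Set.Ioc a b, ENNReal.ofReal ((F' t) ^ 2) := by
  have hftc : ∫ t in a..b, F' t = F b - F a :=
    intervalIntegral.integral_eq_sub_of_hasDerivAt (fun t _ => hF t)
      (hF'.intervalIntegrable _ _)
  rw [← ofReal_integral_eq_lintegral_ofReal, ← ENNReal.ofReal_mul (sub_nonneg.2 hab), ← hftc,
    ← intervalIntegral.integral_of_le hab]
  · exact ENNReal.ofReal_le_ofReal (sq_intervalIntegral_le hab hF')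
  · exact ((hF'.pow 2).intervalIntegrable a b).1
  · exact ae_of_all _ fun t => sq_nonneg _

section Rotation

variable {E : Type*} [NormedAddCommGroup E] [NormedSpace ℝ E]

/-- The rotation of `E × E` with cosine `c` and sine `s`. -/
def rotMap (E : Type*) [NormedAddCommGroup E] [NormedSpace ℝ E] (c s : ℝ) : E × E →ₗ[ℝ] E × E where
  toFun x := (c • x.1 + s • x.2, -s • x.1 + c • x.2)
  map_add' x y := by ext <;> simp <;> module
  map_smul' r x := by ext <;> simp <;> module

lemma rotMap_apply (c s : ℝ) (x : E × E) :
    rotMap E c s x = (c • x.1 + s • x.2, -s • x.1 + c • x.2) := rfl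

lemma abs_det_rotMap {c s : ℝ} (hcs : c ^ 2 + s ^ 2 = 1) :
    |LinearMap.det (rotMap E c s)| = 1 := by
  have h1 : rotMap E c s ∘ₗ rotMap E c (-s) = LinearMap.id := by
    refine LinearMap.ext fun x => ?_
    have e1 : x = ((c ^ 2 + s ^ 2) • x.1, (c ^ 2 + s ^ 2) • x.2) := by simp [hcs]
    rw [LinearMap.id_apply]
    conv_rhs => rw [e1]
    ext <;> simp [rotMap_apply] <;> module
  let J : E × E →ₗ[ℝ] E × E := LinearMap.prodMap LinearMap.id (-LinearMap.id)
  have hJ : J ∘ₗ J = LinearMap.id := by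
    refine LinearMap.ext fun x => ?_
    ext <;> simp [J]
  have h2 : J ∘ₗ rotMap E c s ∘ₗ J = rotMap E c (-s) := by
    refine LinearMap.ext fun x => ?_
    ext <;> simp [rotMap_apply, J]
    module
  have d1 := congrArg LinearMap.det h1
  have d2 := congrArg LinearMap.det h2
  have dJ := congrArg LinearMap.det hJ
  simp only [LinearMap.det_comp, LinearMap.det_id] at d1 d2 dJ
  have d3 : LinearMap.det (rotMap E c s) ^ 2 = 1 := by
    rw [← d2] at d1
    linear_combination d1 - (LinearMap.det (rotMap E c s)) ^ 2 * dJ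
  exact abs_eq_abs.2 (sq_eq_sq_iff_eq_or_eq_neg.1 (d3.trans (one_pow 2).symm)) |>.trans abs_one

variable [MeasurableSpace E] [BorelSpace E] [FiniteDimensional ℝ E]

lemma measurePreserving_rotMap (μ : Measure E) [μ.IsAddHaarMeasure] {c s : ℝ}
    (hcs : c ^ 2 + s ^ 2 = 1) :
    MeasurePreserving (rotMap E c s) (μ.prod μ) (μ.prod μ) := by
  have hdet := abs_det_rotMap (E := E) hcs
  refine ⟨(rotMap E c s).continuous_of_finiteDimensional.measurable, ?_⟩
  rw [Measure.map_linearMap_addHaar_eq_smul_addHaar]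
  · rw [abs_inv, hdet]; simp
  · intro h0; rw [h0] at hdet; simp at hdet

lemma measurePreserving_rotMap_withDensity (μ : Measure E) [μ.IsAddHaarMeasure] {G : E → ENNReal}
    (hG : Measurable G)
    (hrot : ∀ c s : ℝ, c ^ 2 + s ^ 2 = 1 → ∀ w w' : E,
      G (c • w + s • w') * G (-s • w + c • w') = G w * G w')
    [SFinite (μ.withDensity G)] {c s : ℝ} (hcs : c ^ 2 + s ^ 2 = 1) :
    MeasurePreserving (rotMap E c s) ((μ.withDensity G).prod (μ.withDensity G))
      ((μ.withDensity G).prod (μ.withDensity G)) := by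
  have hT := measurePreserving_rotMap μ hcs
  have hGG : Measurable fun z : E × E => G z.1 * G z.2 := by fun_prop
  refine ⟨hT.measurable, ?_⟩
  rw [prod_withDensity hG hG]
  ext A hA
  rw [Measure.map_apply hT.measurable hA, withDensity_apply _ (hT.measurable hA),
    withDensity_apply _ hA, ← hT.setLIntegral_comp_preimage hA hGG]
  simp only [rotMap_apply, hrot c s hcs]

lemma lintegral_sq_sub_le_of_rotation (γ : Measure E) [SFinite γ]
    (hγ : ∀ c s : ℝ, c ^ 2 + s ^ 2 = 1 → MeasurePreserving (rotMap E c s) (γ.prod γ) (γ.prod γ))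
    {f : E → ℝ} (hf : ContDiff ℝ 1 f) :
    ∫⁻ w, ∫⁻ w', ENNReal.ofReal ((f w - f w') ^ 2) ∂γ ∂γ
      ≤ ENNReal.ofReal ((π / 2) ^ 2) *
        ∫⁻ w, ∫⁻ w', ENNReal.ofReal ((fderiv ℝ f w w') ^ 2) ∂γ ∂γ := by
  have hfc : Continuous f := hf.continuous
  have hdf : Continuous (fderiv ℝ f) := hf.continuous_fderiv one_ne_zero
  have hm1 : Measurable fun x : E × E => ENNReal.ofReal ((f x.1 - f x.2) ^ 2) := by
    refine (ENNReal.continuous_ofReal.comp ?_).measurable; fun_prop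
  have hm2 : Measurable fun x : E × E => ENNReal.ofReal ((fderiv ℝ f x.1 x.2) ^ 2) := by
    refine (ENNReal.continuous_ofReal.comp ?_).measurable; fun_prop
  rw [← lintegral_prod (μ := γ) (ν := γ) _ hm1.aemeasurable,
    ← lintegral_prod (μ := γ) (ν := γ) _ hm2.aemeasurable]
  set R := ∫⁻ x : E × E, ENNReal.ofReal ((fderiv ℝ f x.1 x.2) ^ 2) ∂(γ.prod γ)
  have hpath : ∀ x : E × E, ENNReal.ofReal ((f x.1 - f x.2) ^ 2)
      ≤ ENNReal.ofReal (π / 2) * ∫⁻ t in Set.Ioc 0 (π / 2), ENNReal.ofReal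
          ((fderiv ℝ f (rotMap E (cos t) (sin t) x).1 (rotMap E (cos t) (sin t) x).2) ^ 2) := by
    intro x
    have hF : ∀ t, HasDerivAt (fun t => f (cos t • x.1 + sin t • x.2))
        (fderiv ℝ f (rotMap E (cos t) (sin t) x).1 (rotMap E (cos t) (sin t) x).2) t := by
      intro t
      have h1 : HasDerivAt (fun t => cos t • x.1 + sin t • x.2)
          (-sin t • x.1 + cos t • x.2) t :=
        ((hasDerivAt_cos t).smul_const x.1).add ((hasDerivAt_sin t).smul_const x.2)
      exact ((hf.differentiable one_ne_zero _).hasFDerivAt).comp_hasDerivAt t h1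
    have hF' : Continuous fun t => fderiv ℝ f (rotMap E (cos t) (sin t) x).1
        (rotMap E (cos t) (sin t) x).2 := by
      simp only [rotMap_apply]
      fun_prop
    have := ofReal_sq_sub_le_lintegral (a := 0) (b := π / 2) (by positivity) hF hF'
    simpa [sub_sq_comm (f x.2)] using this
  have hm3 : Measurable fun y : (E × E) × ℝ => ENNReal.ofReal ((fderiv ℝ f
      (rotMap E (cos y.2) (sin y.2) y.1).1 (rotMap E (cos y.2) (sin y.2) y.1).2) ^ 2) := by
    refine (ENNReal.continuous_ofReal.comp ?_).measurable
    simp only [rotMap_apply]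
    fun_prop
  calc _ ≤ ∫⁻ x, (ENNReal.ofReal (π / 2) * ∫⁻ t in Set.Ioc 0 (π / 2), ENNReal.ofReal
          ((fderiv ℝ f (rotMap E (cos t) (sin t) x).1 (rotMap E (cos t) (sin t) x).2) ^ 2))
          ∂(γ.prod γ) := lintegral_mono hpath
    _ = ENNReal.ofReal (π / 2) * ∫⁻ t in Set.Ioc 0 (π / 2), ∫⁻ x, ENNReal.ofReal
          ((fderiv ℝ f (rotMap E (cos t) (sin t) x).1 (rotMap E (cos t) (sin t) x).2) ^ 2)
          ∂(γ.prod γ) := by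
        rw [lintegral_const_mul' _ _ ENNReal.ofReal_ne_top,
          lintegral_lintegral_swap hm3.aemeasurable]
    _ = ENNReal.ofReal (π / 2) * ∫⁻ t in Set.Ioc 0 (π / 2), R := by
        congr 2
        ext t
        exact (hγ _ _ (cos_sq_add_sin_sq t)).lintegral_comp hm2
    _ = _ := by
        rw [lintegral_const, Measure.restrict_apply MeasurableSet.univ, Set.univ_inter,
          Real.volume_Ioc, sub_zero, sq, ENNReal.ofReal_mul (by positivity)]
        ring

end Rotation

lemma sq_linearMap_pi_le {d : ℕ} (L : (Fin d → ℝ) →ₗ[ℝ] ℝ) (v : Fin d → ℝ) :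
    (L v) ^ 2 ≤ (∑ k, (L (Pi.single k 1)) ^ 2) * ∑ k, (v k) ^ 2 := by
  have hv : L v = ∑ k, L (Pi.single k 1) * v k := by
    conv_lhs => rw [← Finset.univ_sum_single v, map_sum]
    refine Finset.sum_congr rfl fun k _ => ?_
    rw [mul_comm, ← smul_eq_mul, ← map_smul, ← Pi.single_smul, smul_eq_mul, mul_one]
  rw [hv]
  exact Finset.sum_mul_sq_le_sq_mul_sq _ _ _

lemma cube_eq_pi (d : ℕ) : cube d = Set.univ.pi fun _ => Set.Ico (0 : ℝ) 1 := by
  ext q; simp [cube]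

lemma measurableSet_cube (d : ℕ) : MeasurableSet (cube d) := by
  rw [cube_eq_pi]
  exact MeasurableSet.univ_pi fun _ => measurableSet_Ico

lemma convex_cube (d : ℕ) : Convex ℝ (cube d) := by
  rw [cube_eq_pi]
  exact convex_pi fun _ _ => convex_Ico 0 1

lemma volume_cube (d : ℕ) : volume (cube d) = 1 := by
  rw [cube_eq_pi, volume_pi_pi]
  simp

lemma cube_subset_Icc (d : ℕ) : cube d ⊆ Set.Icc 0 1 :=
  fun _ hq => ⟨fun i => (hq i).1, fun i => (hq i).2.le⟩

lemma lintegral_comp_add_smul {d : ℕ} {F : (Fin d → ℝ) → ENNReal} (hF : Measurable F)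
    (a : Fin d → ℝ) {t : ℝ} (ht : 0 < t) :
    ∫⁻ y, F (a + t • y) = ENNReal.ofReal ((t ^ d)⁻¹) * ∫⁻ y, F y := by
  have h1 : ∫⁻ y, F (a + t • y) = ∫⁻ y, F (a + y) ∂(Measure.map (t • ·) volume) :=
    (lintegral_map (f := fun y => F (a + y)) (by fun_prop) (measurable_const_smul t)).symm
  rw [h1, Measure.map_addHaar_smul _ ht.ne', lintegral_smul_measure,
    lintegral_add_left_eq_self, Module.finrank_fin_fun, abs_of_pos (by positivity), smul_eq_mul]

lemma setLIntegral_cube_convexComb_le {d : ℕ} {g : (Fin d → ℝ) → ENNReal} (hg : Measurable g)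
    {t : ℝ} (ht : t ∈ Set.Icc (2⁻¹ : ℝ) 1) {q : Fin d → ℝ} (hq : q ∈ cube d) :
    ∫⁻ q' in cube d, g ((1 - t) • q + t • q') ≤ ENNReal.ofReal (2 ^ d) * ∫⁻ y in cube d, g y := by
  have ht0 : 0 < t := lt_of_lt_of_le (by norm_num) ht.1
  have hm := measurableSet_cube d
  calc ∫⁻ q' in cube d, g ((1 - t) • q + t • q')
      = ∫⁻ q' in cube d, (cube d).indicator g ((1 - t) • q + t • q') := by
        refine setLIntegral_congr_fun hm fun q' hq' => ?_
        have : (1 - t) • q + t • q' ∈ cube d :=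
          convex_cube d hq hq' (sub_nonneg.2 ht.2) ht0.le (by ring)
        simp [this]
    _ ≤ ∫⁻ q', (cube d).indicator g ((1 - t) • q + t • q') := setLIntegral_le_lintegral _ _
    _ = ENNReal.ofReal ((t ^ d)⁻¹) * ∫⁻ y in cube d, g y := by
        rw [lintegral_comp_add_smul (hg.indicator hm) _ ht0, lintegral_indicator hm]
    _ ≤ _ := by
        gcongr
        rw [← inv_pow]
        gcongr
        exact inv_le_of_inv_le₀ (by norm_num) ht.1

lemma lintegral_cube_cube_convexComb_le {d : ℕ} {g : (Fin d → ℝ) → ENNReal} (hg : Measurable g)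
    {t : ℝ} (ht : t ∈ Set.Icc (0 : ℝ) 1) :
    ∫⁻ q in cube d, ∫⁻ q' in cube d, g ((1 - t) • q + t • q')
      ≤ ENNReal.ofReal (2 ^ d) * ∫⁻ y in cube d, g y := by
  have hm := measurableSet_cube d
  have key : ∀ s ∈ Set.Icc (2⁻¹ : ℝ) 1,
      ∫⁻ q in cube d, ∫⁻ q' in cube d, g ((1 - s) • q + s • q')
        ≤ ENNReal.ofReal (2 ^ d) * ∫⁻ y in cube d, g y := fun s hs =>
    calc _ ≤ ∫⁻ _q in cube d, ENNReal.ofReal (2 ^ d) * ∫⁻ y in cube d, g y :=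
          setLIntegral_mono measurable_const fun q hq => setLIntegral_cube_convexComb_le hg hs hq
      _ = _ := by rw [setLIntegral_const, volume_cube, mul_one]
  rcases le_total (2⁻¹ : ℝ) t with h | h
  · exact key t ⟨h, ht.2⟩
  · rw [lintegral_lintegral_swap (Measurable.aemeasurable (by fun_prop))]
    refine le_trans (le_of_eq ?_) (key (1 - t) ⟨by linarith, by linarith [ht.1]⟩)
    simp only [sub_sub_cancel, add_comm]

lemma lintegral_cube_sq_sub_le {d : ℕ} {f : (Fin d → ℝ) → ℝ} (hf : ContDiff ℝ 1 f) :
    ∫⁻ q in cube d, ∫⁻ q' in cube d, ENNReal.ofReal ((f q - f q') ^ 2)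
      ≤ ENNReal.ofReal d * ENNReal.ofReal (2 ^ d) *
        ∫⁻ q in cube d, ENNReal.ofReal (∑ k, (fderiv ℝ f q (Pi.single k 1)) ^ 2) := by
  have hdf : Continuous (fderiv ℝ f) := hf.continuous_fderiv one_ne_zero
  have hm := measurableSet_cube d
  set g : (Fin d → ℝ) → ENNReal :=
    fun q => ENNReal.ofReal (∑ k, (fderiv ℝ f q (Pi.single k 1)) ^ 2) with hgdef
  have hg : Measurable g := by
    refine (ENNReal.continuous_ofReal.comp ?_).measurable; fun_prop
  have hpath : ∀ q ∈ cube d, ∀ q' ∈ cube d, ENNReal.ofReal ((f q - f q') ^ 2)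
      ≤ ENNReal.ofReal d * ∫⁻ t in Set.Ioc (0 : ℝ) 1, g ((1 - t) • q + t • q') := by
    intro q hq q' hq'
    have hF : ∀ t : ℝ, HasDerivAt (fun t : ℝ => f ((1 - t) • q + t • q'))
        (fderiv ℝ f ((1 - t) • q + t • q') (q' - q)) t := by
      intro t
      have h1 : HasDerivAt (fun t : ℝ => (1 - t) • q + t • q') (q' - q) t := by
        have := (((hasDerivAt_id t).const_sub 1).smul_const q).add
          ((hasDerivAt_id t).smul_const q')
        exact this.congr_deriv (by module)
      exact ((hf.differentiable one_ne_zero _).hasFDerivAt).comp_hasDerivAt t h1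
    have h2 := ofReal_sq_sub_le_lintegral (a := 0) (b := 1) zero_le_one hF (by fun_prop)
    simp only [sub_zero, sub_self, zero_smul, one_smul, zero_add, add_zero, ENNReal.ofReal_one,
      one_mul, sub_sq_comm (f q')] at h2
    refine h2.trans ?_
    rw [← lintegral_const_mul' _ _ ENNReal.ofReal_ne_top]
    refine lintegral_mono fun t => ?_
    rw [hgdef, ← ENNReal.ofReal_mul (Nat.cast_nonneg d), mul_comm]
    refine ENNReal.ofReal_le_ofReal ((sq_linearMap_pi_le (fderiv ℝ f _).toLinearMap _).trans ?_)
    refine mul_le_mul_of_nonneg_left ?_ (Finset.sum_nonneg fun _ _ => sq_nonneg _)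
    calc ∑ k, ((q' - q) k) ^ 2 ≤ ∑ _k : Fin d, (1 : ℝ) := by
          refine Finset.sum_le_sum fun k _ => ?_
          rw [Pi.sub_apply, sq_le_one_iff_abs_le_one, abs_le]
          constructor <;> linarith [(hq k).1, (hq k).2, (hq' k).1, (hq' k).2]
      _ = d := by simp
  calc _ ≤ ∫⁻ q in cube d, ∫⁻ q' in cube d,
          ENNReal.ofReal d * ∫⁻ t in Set.Ioc (0 : ℝ) 1, g ((1 - t) • q + t • q') :=
        lintegral_mono_ae <| (ae_restrict_mem hm).mono fun q hq =>
          lintegral_mono_ae <| (ae_restrict_mem hm).mono fun q' hq' => hpath q hq q' hq'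
    _ = ENNReal.ofReal d * ∫⁻ q in cube d, ∫⁻ q' in cube d, ∫⁻ t in Set.Ioc (0 : ℝ) 1,
          g ((1 - t) • q + t • q') := by
        simp only [lintegral_const_mul' _ _ ENNReal.ofReal_ne_top]
    _ = ENNReal.ofReal d * ∫⁻ t in Set.Ioc (0 : ℝ) 1, ∫⁻ q in cube d, ∫⁻ q' in cube d,
          g ((1 - t) • q + t • q') := by
        congr 1
        have h1 : ∀ q : Fin d → ℝ, ∫⁻ q' in cube d, ∫⁻ t in Set.Ioc (0 : ℝ) 1,
            g ((1 - t) • q + t • q') = ∫⁻ t in Set.Ioc (0 : ℝ) 1, ∫⁻ q' in cube d,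
            g ((1 - t) • q + t • q') := fun q =>
          lintegral_lintegral_swap (Measurable.aemeasurable (by fun_prop))
        simp only [h1]
        refine lintegral_lintegral_swap (Measurable.aemeasurable ?_)
        refine Measurable.lintegral_prod_right' (f := fun y : ((Fin d → ℝ) × ℝ) × (Fin d → ℝ) =>
          g ((1 - y.1.2) • y.1.1 + y.1.2 • y.2)) ?_
        fun_prop
    _ ≤ ENNReal.ofReal d * ∫⁻ _t in Set.Ioc (0 : ℝ) 1,
          ENNReal.ofReal (2 ^ d) * ∫⁻ y in cube d, g y := by
        gcongr ENNReal.ofReal d * ?_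
        exact setLIntegral_mono measurable_const fun t ht =>
          lintegral_cube_cube_convexComb_le hg ⟨ht.1.le, ht.2⟩
    _ = _ := by
        rw [setLIntegral_const, Real.volume_Ioc]
        simp [mul_assoc]

lemma lintegral_prod_sq_sub_le {A E : Type*} [MeasurableSpace A] [MeasurableSpace E]
    (κ : Measure A) (γ : Measure E) [SFinite κ] [SFinite γ] {h : A × E → ℝ} (hh : Measurable h) :
    ∫⁻ x, ∫⁻ y, ENNReal.ofReal ((h x - h y) ^ 2) ∂(κ.prod γ) ∂(κ.prod γ)
      ≤ 2 * (γ Set.univ *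
            ∫⁻ w, ∫⁻ q, ∫⁻ q', ENNReal.ofReal ((h (q, w) - h (q', w)) ^ 2) ∂κ ∂κ ∂γ
          + κ Set.univ *
            ∫⁻ q, ∫⁻ w, ∫⁻ w', ENNReal.ofReal ((h (q, w) - h (q, w')) ^ 2) ∂γ ∂γ ∂κ) := by
  set a : E → A → A → ENNReal :=
    fun w q q' => ENNReal.ofReal ((h (q, w) - h (q', w)) ^ 2) with ha
  set b : A → E → E → ENNReal :=
    fun q w w' => ENNReal.ofReal ((h (q, w) - h (q, w')) ^ 2) with hb
  have hma : Measurable fun y : (E × A) × A => a y.1.1 y.1.2 y.2 := by fun_prop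
  have hmb : Measurable fun y : (A × E) × E => b y.1.1 y.1.2 y.2 := by fun_prop
  have hma' : Measurable fun y : E × A => ∫⁻ q', a y.1 y.2 q' ∂κ := hma.lintegral_prod_right'
  have hmb' : Measurable fun y : A × E => ∫⁻ w', b y.1 y.2 w' ∂γ := hmb.lintegral_prod_right'
  have hpt : ∀ q w q' w', ENNReal.ofReal ((h (q, w) - h (q', w')) ^ 2)
      ≤ 2 * a w q q' + 2 * b q' w w' := by
    intro q w q' w'
    rw [ha, hb, ← mul_add, ← ENNReal.ofReal_add (sq_nonneg _) (sq_nonneg _),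
      ← ENNReal.ofReal_ofNat, ← ENNReal.ofReal_mul zero_le_two]
    refine ENNReal.ofReal_le_ofReal ?_
    nlinarith [sq_nonneg ((h (q, w) - h (q', w)) - (h (q', w) - h (q', w')))]
  have hmh : Measurable fun y : (A × E) × (A × E) => ENNReal.ofReal ((h y.1 - h y.2) ^ 2) := by
    fun_prop
  calc _ = ∫⁻ q, ∫⁻ w, ∫⁻ q', ∫⁻ w', ENNReal.ofReal ((h (q, w) - h (q', w')) ^ 2)
          ∂γ ∂κ ∂γ ∂κ := by
        rw [lintegral_prod _ hmh.lintegral_prod_right'.aemeasurable]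
        refine lintegral_congr fun q => lintegral_congr fun w => ?_
        rw [lintegral_prod _ (Measurable.aemeasurable (by fun_prop))]
    _ ≤ ∫⁻ q, ∫⁻ w, ∫⁻ q', ∫⁻ w', (2 * a w q q' + 2 * b q' w w') ∂γ ∂κ ∂γ ∂κ := by
        gcongr with q w q' w'
        exact hpt q w q' w'
    _ = ∫⁻ q, ∫⁻ w, (2 * γ Set.univ * ∫⁻ q', a w q q' ∂κ
          + 2 * ∫⁻ q', ∫⁻ w', b q' w w' ∂γ ∂κ) ∂γ ∂κ := by
        refine lintegral_congr fun q => lintegral_congr fun w => ?_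
        have : ∀ q', ∫⁻ w', (2 * a w q q' + 2 * b q' w w') ∂γ
            = 2 * γ Set.univ * a w q q' + 2 * ∫⁻ w', b q' w w' ∂γ := by
          intro q'
          rw [lintegral_add_left measurable_const, lintegral_const,
            lintegral_const_mul' _ _ (by simp)]
          ring
        simp only [this]
        rw [lintegral_add_left (by fun_prop), lintegral_const_mul _ (by fun_prop),
          lintegral_const_mul' _ _ (by simp)]
    _ = 2 * γ Set.univ * ∫⁻ q, ∫⁻ w, ∫⁻ q', a w q q' ∂κ ∂γ ∂κ
          + κ Set.univ * (2 * ∫⁻ w, ∫⁻ q', ∫⁻ w', b q' w w' ∂γ ∂κ ∂γ) := by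
        have hm1 : Measurable fun y : A × E => ∫⁻ q', a y.2 y.1 q' ∂κ :=
          hma'.comp measurable_swap
        have : ∀ q, ∫⁻ w, (2 * γ Set.univ * ∫⁻ q', a w q q' ∂κ
            + 2 * ∫⁻ q', ∫⁻ w', b q' w w' ∂γ ∂κ) ∂γ
            = 2 * γ Set.univ * ∫⁻ w, ∫⁻ q', a w q q' ∂κ ∂γ
              + 2 * ∫⁻ w, ∫⁻ q', ∫⁻ w', b q' w w' ∂γ ∂κ ∂γ := by
          intro q
          have hq : Measurable fun w => ∫⁻ q', a w q q' ∂κ := hm1.comp measurable_prodMk_left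
          rw [lintegral_add_left (hq.const_mul _), lintegral_const_mul _ hq,
            lintegral_const_mul' _ _ (by simp)]
        simp only [this]
        rw [lintegral_add_right _ measurable_const, lintegral_const,
          lintegral_const_mul _ hm1.lintegral_prod_right', mul_comm (κ Set.univ)]
    _ = _ := by
        rw [lintegral_lintegral_swap (f := fun q w => ∫⁻ q', a w q q' ∂κ)
            (hma'.comp measurable_swap).aemeasurable,
          lintegral_lintegral_swap (f := fun w q' => ∫⁻ w', b q' w w' ∂γ)
            (hmb'.comp measurable_swap).aemeasurable]
        ring

/-- The velocity part `|p|² + |z|²` of (twice) the energy. -/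
def kin (d m : ℕ) (w : (Fin d → ℝ) × (Fin m → Fin d → ℝ)) : ℝ :=
  ∑ i, (w.1 i) ^ 2 + ∑ j, ∑ i, (w.2 j i) ^ 2

@[fun_prop]
lemma continuous_kin (d m : ℕ) : Continuous (kin d m) := by
  unfold kin
  fun_prop

lemma kin_nonneg (d m : ℕ) (w : (Fin d → ℝ) × (Fin m → Fin d → ℝ)) : 0 ≤ kin d m w := by
  unfold kin
  positivity

lemma kin_rotation (d m : ℕ) {c s : ℝ} (hcs : c ^ 2 + s ^ 2 = 1)
    (w w' : (Fin d → ℝ) × (Fin m → Fin d → ℝ)) :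
    kin d m (c • w + s • w') + kin d m (-s • w + c • w') = kin d m w + kin d m w' := by
  have key : ∀ a b : ℝ, (c * a + s * b) ^ 2 + (-s * a + c * b) ^ 2 = a ^ 2 + b ^ 2 := by
    intro a b
    linear_combination (a ^ 2 + b ^ 2) * hcs
  simp only [kin, Prod.fst_add, Prod.snd_add, Prod.smul_fst, Prod.smul_snd, Pi.add_apply,
    Pi.smul_apply, smul_eq_mul]
  rw [add_add_add_comm, add_add_add_comm (∑ i, (w.1 i) ^ 2)]
  simp only [← Finset.sum_add_distrib, key]

lemma integrable_exp_neg_kin (d m : ℕ) {b : ℝ} (hb : 0 < b) :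
    Integrable fun w : (Fin d → ℝ) × (Fin m → Fin d → ℝ) => exp (-b * kin d m w) := by
  have h1 : Integrable fun p : Fin d → ℝ => ∏ i, exp (-b * (p i) ^ 2) :=
    Integrable.fintype_prod (f := fun _ (x : ℝ) => exp (-b * x ^ 2))
      fun _ => integrable_exp_neg_mul_sq hb
  have h2 : Integrable fun z : Fin m → Fin d → ℝ => ∏ j, ∏ i, exp (-b * (z j i) ^ 2) :=
    Integrable.fintype_prod (f := fun _ (p : Fin d → ℝ) => ∏ i, exp (-b * (p i) ^ 2)) fun _ => h1
  refine (h1.mul_prod h2).congr (ae_of_all _ fun w => ?_)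
  simp only [kin, ← exp_sum, ← Finset.mul_sum, ← exp_add, mul_add]

/-- The unnormalised Gaussian measure of variance `β⁻¹` in the variables `(p, z)`. -/
def velMeasure (d m : ℕ) (β : ℝ) : Measure ((Fin d → ℝ) × (Fin m → Fin d → ℝ)) :=
  volume.withDensity fun w => ENNReal.ofReal (exp (-(β / 2) * kin d m w))

lemma velMeasure_univ_lt_top (d m : ℕ) {β : ℝ} (hβ : 0 < β) :
    velMeasure d m β Set.univ < ⊤ := by
  rw [velMeasure, withDensity_apply _ MeasurableSet.univ, Measure.restrict_univ]
  exact (integrable_exp_neg_kin d m (half_pos hβ)).lintegral_lt_top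

lemma lintegral_kin_lt_top (d m : ℕ) {β : ℝ} (hβ : 0 < β) :
    ∫⁻ w, ENNReal.ofReal (kin d m w) ∂(velMeasure d m β) < ⊤ := by
  rw [velMeasure, lintegral_withDensity_eq_lintegral_mul _ (by fun_prop) (by fun_prop)]
  refine lt_of_le_of_lt (lintegral_mono fun w => ?_)
    (((integrable_exp_neg_kin d m (b := β / 4) (by positivity)).const_mul
      (4 / β)).lintegral_lt_top)
  rw [Pi.mul_apply, ← ENNReal.ofReal_mul (exp_pos _).le]
  refine ENNReal.ofReal_le_ofReal ?_
  have h1 : kin d m w ≤ 4 / β * exp (β / 4 * kin d m w) := by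
    have := add_one_le_exp (β / 4 * kin d m w)
    calc kin d m w = 4 / β * (β / 4 * kin d m w) := by field_simp
      _ ≤ _ := by gcongr; linarith
  calc exp (-(β / 2) * kin d m w) * kin d m w
      ≤ exp (-(β / 2) * kin d m w) * (4 / β * exp (β / 4 * kin d m w)) := by gcongr
    _ = 4 / β * exp (-(β / 4) * kin d m w) := by
      rw [mul_left_comm, ← exp_add]
      ring_nf

lemma measurePreserving_rotMap_velMeasure (d m : ℕ) {β : ℝ} (hβ : 0 < β) {c s : ℝ}
    (hcs : c ^ 2 + s ^ 2 = 1) :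
    MeasurePreserving (rotMap ((Fin d → ℝ) × (Fin m → Fin d → ℝ)) c s)
      ((velMeasure d m β).prod (velMeasure d m β))
      ((velMeasure d m β).prod (velMeasure d m β)) := by
  have : IsFiniteMeasure (velMeasure d m β) := ⟨velMeasure_univ_lt_top d m hβ⟩
  have h1 : (volume : Measure (Fin m → Fin d → ℝ)).IsAddHaarMeasure :=
    Measure.pi.isAddHaarMeasure _
  have h2 : (volume : Measure ((Fin d → ℝ) × (Fin m → Fin d → ℝ))).IsAddHaarMeasure :=
    Measure.prod.instIsAddHaarMeasure _ _
  unfold velMeasure at this ⊢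
  refine measurePreserving_rotMap_withDensity volume (by fun_prop) (fun c s hcs w w' => ?_) hcs
  rw [← ENNReal.ofReal_mul (exp_pos _).le, ← ENNReal.ofReal_mul (exp_pos _).le, ← exp_add,
    ← exp_add, ← mul_add, ← mul_add, kin_rotation d m hcs]

/-- The squared norm of the full gradient, in the case `m = 1`. -/
def gradSq (d : ℕ) (h : Xsp d 1 → ℝ) (x : Xsp d 1) : ℝ :=
  ∑ k, (pZ d 1 0 k h x) ^ 2 + ∑ k, (pP d 1 k h x) ^ 2 + ∑ k, (pQ d 1 k h x) ^ 2

/-- The integrand of the Dirichlet form of `P`. -/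
def dirichletP (d : ℕ) (h : Xsp d 1 → ℝ) (x : Xsp d 1) : ℝ :=
  ∑ k, (pZ d 1 0 k h x) ^ 2 + ∑ k, (pP d 1 k h x) ^ 2
    + ∑ k, (pZ d 1 0 k h x - pQ d 1 k h x) ^ 2

lemma gradSq_le (d : ℕ) (h : Xsp d 1 → ℝ) (x : Xsp d 1) : gradSq d h x ≤ 3 * dirichletP d h x := by
  have h1 : ∑ k, (pQ d 1 k h x) ^ 2 ≤ 2 * ∑ k, (pZ d 1 0 k h x) ^ 2
      + 2 * ∑ k, (pZ d 1 0 k h x - pQ d 1 k h x) ^ 2 := by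
    rw [Finset.mul_sum, Finset.mul_sum, ← Finset.sum_add_distrib]
    refine Finset.sum_le_sum fun k _ => ?_
    nlinarith [sq_nonneg (2 * pZ d 1 0 k h x - pQ d 1 k h x)]
  have h2 : 0 ≤ ∑ k, (pP d 1 k h x) ^ 2 := Finset.sum_nonneg fun _ _ => sq_nonneg _
  have h3 : 0 ≤ ∑ k, (pZ d 1 0 k h x - pQ d 1 k h x) ^ 2 :=
    Finset.sum_nonneg fun _ _ => sq_nonneg _
  unfold gradSq dirichletP
  linarith

lemma sq_fderiv_vel_le (d : ℕ) (h : Xsp d 1 → ℝ) (x : Xsp d 1)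
    (w : (Fin d → ℝ) × (Fin 1 → Fin d → ℝ)) :
    (fderiv ℝ h x (0, w)) ^ 2 ≤ 2 * gradSq d h x * kin d 1 w := by
  set D := fderiv ℝ h x with hD
  let LP : (Fin d → ℝ) →ₗ[ℝ] ℝ :=
    D.toLinearMap ∘ₗ LinearMap.inr ℝ (Fin d → ℝ) _ ∘ₗ LinearMap.inl ℝ (Fin d → ℝ) _
  let LZ : (Fin d → ℝ) →ₗ[ℝ] ℝ :=
    D.toLinearMap ∘ₗ LinearMap.inr ℝ (Fin d → ℝ) _ ∘ₗ LinearMap.inr ℝ (Fin d → ℝ) _ ∘ₗ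
      LinearMap.single ℝ (fun _ : Fin 1 => Fin d → ℝ) 0
  have hP : ∀ v, LP v = D (0, v, 0) := fun v => rfl
  have hZ : ∀ v, LZ v = D (zdir d 1 0 v) := fun v => rfl
  have hsplit : D (0, w) = LP w.1 + LZ (w.2 0) := by
    rw [hP, hZ, ← map_add]
    congr 1
    ext i j
    · simp [zdir]
    · simp [zdir]
    · simp [zdir, Subsingleton.elim i 0]
  have e1 := sq_linearMap_pi_le LP w.1
  have e2 := sq_linearMap_pi_le LZ (w.2 0)
  have e3 : ∑ k, (LP (Pi.single k 1)) ^ 2 = ∑ k, (pP d 1 k h x) ^ 2 := rfl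
  have e4 : ∑ k, (LZ (Pi.single k 1)) ^ 2 = ∑ k, (pZ d 1 0 k h x) ^ 2 := rfl
  rw [e3] at e1
  rw [e4] at e2
  have a0 : 0 ≤ ∑ k, (pP d 1 k h x) ^ 2 := Finset.sum_nonneg fun _ _ => sq_nonneg _
  have b0 : 0 ≤ ∑ k, (pZ d 1 0 k h x) ^ 2 := Finset.sum_nonneg fun _ _ => sq_nonneg _
  have c0 : 0 ≤ ∑ k, (pQ d 1 k h x) ^ 2 := Finset.sum_nonneg fun _ _ => sq_nonneg _
  have p0 : 0 ≤ ∑ k, (w.1 k) ^ 2 := Finset.sum_nonneg fun _ _ => sq_nonneg _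
  have z0 : 0 ≤ ∑ k, (w.2 0 k) ^ 2 := Finset.sum_nonneg fun _ _ => sq_nonneg _
  rw [hsplit, gradSq, kin, Fin.sum_univ_one]
  nlinarith [sq_nonneg (LP w.1 - LZ (w.2 0)), mul_nonneg a0 z0, mul_nonneg b0 p0,
    mul_nonneg c0 p0, mul_nonneg c0 z0]

/-- The unperturbed (`V = 0`), unnormalised reference measure. -/
def refMeasure (d : ℕ) (β : ℝ) : Measure (Xsp d 1) :=
  (volume.restrict (cube d)).prod (velMeasure d 1 β)

lemma continuous_pZ {d : ℕ} {h : Xsp d 1 → ℝ} (hh : ContDiff ℝ 1 h) (k : Fin d) :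
    Continuous (pZ d 1 0 k h) :=
  (hh.continuous_fderiv one_ne_zero).clm_apply continuous_const

lemma continuous_pP {d : ℕ} {h : Xsp d 1 → ℝ} (hh : ContDiff ℝ 1 h) (k : Fin d) :
    Continuous (pP d 1 k h) :=
  (hh.continuous_fderiv one_ne_zero).clm_apply continuous_const

lemma continuous_pQ {d : ℕ} {h : Xsp d 1 → ℝ} (hh : ContDiff ℝ 1 h) (k : Fin d) :
    Continuous (pQ d 1 k h) :=
  (hh.continuous_fderiv one_ne_zero).clm_apply continuous_const

lemma continuous_gradSq {d : ℕ} {h : Xsp d 1 → ℝ} (hh : ContDiff ℝ 1 h) :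
    Continuous (gradSq d h) := by
  have h1 := continuous_pZ hh
  have h2 := continuous_pP hh
  have h3 := continuous_pQ hh
  unfold gradSq
  fun_prop

lemma continuous_dirichletP {d : ℕ} {h : Xsp d 1 → ℝ} (hh : ContDiff ℝ 1 h) :
    Continuous (dirichletP d h) := by
  have h1 := continuous_pZ hh
  have h2 := continuous_pP hh
  have h3 := continuous_pQ hh
  unfold dirichletP
  fun_prop

lemma exists_poincare_refMeasure (d : ℕ) {β : ℝ} (hβ : 0 < β) :
    ∃ C : ENNReal, C ≠ ⊤ ∧ ∀ h : Xsp d 1 → ℝ, ContDiff ℝ 1 h →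
      ∫⁻ x, ∫⁻ y, ENNReal.ofReal ((h x - h y) ^ 2) ∂(refMeasure d β) ∂(refMeasure d β)
        ≤ C * ∫⁻ x, ENNReal.ofReal (gradSq d h x) ∂(refMeasure d β) := by
  have : IsFiniteMeasure (velMeasure d 1 β) := ⟨velMeasure_univ_lt_top d 1 hβ⟩
  set N := velMeasure d 1 β Set.univ with hN
  set M := ∫⁻ w, ENNReal.ofReal (kin d 1 w) ∂(velMeasure d 1 β) with hM
  have hNtop : N ≠ ⊤ := (velMeasure_univ_lt_top d 1 hβ).ne
  have hMtop : M ≠ ⊤ := (lintegral_kin_lt_top d 1 hβ).ne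
  set C₁ := ENNReal.ofReal d * ENNReal.ofReal (2 ^ d) with hC₁
  set C₂ := ENNReal.ofReal ((π / 2) ^ 2) with hC₂
  refine ⟨2 * (N * C₁ + C₂ * (2 * M)), ?_, fun h hh => ?_⟩
  · have : C₁ ≠ ⊤ := ENNReal.mul_ne_top ENNReal.ofReal_ne_top ENNReal.ofReal_ne_top
    have : C₂ ≠ ⊤ := ENNReal.ofReal_ne_top
    finiteness
  set S : Xsp d 1 → ENNReal := fun x => ENNReal.ofReal (gradSq d h x) with hS
  have hSm : Measurable S := (ENNReal.continuous_ofReal.comp (continuous_gradSq hh)).measurable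
  have hder : ∀ x, HasFDerivAt h (fderiv ℝ h x) x := fun x =>
    (hh.differentiable one_ne_zero x).hasFDerivAt
  have hq : ∀ w, ∫⁻ q in cube d, ∫⁻ q' in cube d, ENNReal.ofReal ((h (q, w) - h (q', w)) ^ 2)
      ≤ C₁ * ∫⁻ q in cube d, S (q, w) := by
    intro w
    refine (lintegral_cube_sq_sub_le (f := fun q => h (q, w))
      (hh.comp (contDiff_id.prodMk contDiff_const))).trans ?_
    gcongr with q
    refine ENNReal.ofReal_le_ofReal ?_
    have hd : fderiv ℝ (fun q => h (q, w)) q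
        = (fderiv ℝ h (q, w)).comp (ContinuousLinearMap.inl ℝ _ _) :=
      ((hder (q, w)).comp q (hasFDerivAt_prodMk_left q w)).fderiv
    have h1 : 0 ≤ ∑ k, (pP d 1 k h (q, w)) ^ 2 := Finset.sum_nonneg fun _ _ => sq_nonneg _
    have h2 : 0 ≤ ∑ k, (pZ d 1 0 k h (q, w)) ^ 2 := Finset.sum_nonneg fun _ _ => sq_nonneg _
    have h3 : ∑ k, (fderiv ℝ (fun q => h (q, w)) q (Pi.single k 1)) ^ 2
        = ∑ k, (pQ d 1 k h (q, w)) ^ 2 := by rw [hd]; rfl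
    rw [h3, gradSq]
    linarith
  have hw : ∀ q, ∫⁻ w, ∫⁻ w', ENNReal.ofReal ((h (q, w) - h (q, w')) ^ 2)
        ∂(velMeasure d 1 β) ∂(velMeasure d 1 β)
      ≤ C₂ * (2 * M) * ∫⁻ w, S (q, w) ∂(velMeasure d 1 β) := by
    intro q
    refine (lintegral_sq_sub_le_of_rotation (velMeasure d 1 β)
      (fun c s hcs => measurePreserving_rotMap_velMeasure d 1 hβ hcs) (f := fun w => h (q, w))
      (hh.comp (contDiff_const.prodMk contDiff_id))).trans ?_
    rw [mul_assoc]
    gcongr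
    rw [← lintegral_const_mul' _ _ (by finiteness)]
    refine lintegral_mono fun w => ?_
    have hd : fderiv ℝ (fun w => h (q, w)) w
        = (fderiv ℝ h (q, w)).comp (ContinuousLinearMap.inr ℝ _ _) :=
      ((hder (q, w)).comp w (hasFDerivAt_prodMk_right q w)).fderiv
    rw [mul_right_comm, hM, ← lintegral_const_mul' _ _ (by finiteness)]
    refine lintegral_mono fun w' => ?_
    rw [hS, ← ENNReal.ofReal_ofNat, ← ENNReal.ofReal_mul zero_le_two,
      ← ENNReal.ofReal_mul' (kin_nonneg d 1 w')]
    refine ENNReal.ofReal_le_ofReal ?_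
    rw [hd]
    exact sq_fderiv_vel_le d h (q, w) w'
  refine (lintegral_prod_sq_sub_le (volume.restrict (cube d)) (velMeasure d 1 β)
    hh.continuous.measurable).trans ?_
  rw [mul_assoc]
  gcongr 2 * ?_
  rw [add_mul, Measure.restrict_apply MeasurableSet.univ, Set.univ_inter, volume_cube, one_mul,
    mul_assoc]
  gcongr ?_ + ?_
  · gcongr N * ?_
    refine (lintegral_mono hq).trans ?_
    rw [lintegral_const_mul _ (by fun_prop), refMeasure, lintegral_prod_symm _ hSm.aemeasurable]
  · refine (lintegral_mono hw).trans ?_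
    rw [lintegral_const_mul _ (by fun_prop), refMeasure, lintegral_prod _ hSm.aemeasurable]

lemma refMeasure_eq_withDensity (d : ℕ) (β : ℝ) :
    refMeasure d β = (volX d 1).withDensity
      fun x => ENNReal.ofReal (exp (-(β / 2) * kin d 1 x.2)) := by
  have hset : {x : Xsp d 1 | x.1 ∈ cube d} = cube d ×ˢ Set.univ := by
    ext x; simp
  rw [volX, hset, Measure.volume_eq_prod, ← Measure.prod_restrict, Measure.restrict_univ]
  exact prod_withDensity_right (by fun_prop)

lemma gdens_eq (d : ℕ) (β : ℝ) (V : (Fin d → ℝ) → ℝ) (x : Xsp d 1) :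
    gdens d 1 β V x = exp (-β * V x.1) * exp (-(β / 2) * kin d 1 x.2) := by
  rw [gdens, kin, ← exp_add]
  ring_nf

lemma ae_mem_cube_volX (d m : ℕ) : ∀ᵐ x ∂(volX d m), x.1 ∈ cube d :=
  ae_restrict_mem (measurable_fst (measurableSet_cube d))

lemma ae_mem_cube_gibbs (d m : ℕ) (β Z : ℝ) (V : (Fin d → ℝ) → ℝ) :
    ∀ᵐ x ∂(gibbs d m β Z V), x.1 ∈ cube d :=
  (withDensity_absolutelyContinuous _ _).ae_le (ae_mem_cube_volX d m)

lemma exists_gibbs_le_le (d : ℕ) {β : ℝ} (hβ : 0 < β) {V : (Fin d → ℝ) → ℝ} (hV : Continuous V)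
    {Z : ℝ} (hZ : 0 < Z) :
    ∃ C : ENNReal, C ≠ ⊤ ∧ gibbs d 1 β Z V ≤ C • refMeasure d β ∧
      refMeasure d β ≤ C • gibbs d 1 β Z V := by
  obtain ⟨M, hM⟩ := (isCompact_Icc (a := (0 : Fin d → ℝ)) (b := 1)).exists_bound_of_continuousOn
    hV.continuousOn
  have hVM : ∀ q ∈ cube d, -M ≤ V q ∧ V q ≤ M := fun q hq => by
    have := hM q (cube_subset_Icc d hq)
    rwa [Real.norm_eq_abs, abs_le] at this
  set c : ℝ := max Z Z⁻¹ * exp (β * M) with hc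
  have hexp : ∀ q ∈ cube d, exp (-β * V q) ≤ exp (β * M) ∧ 1 ≤ exp (β * M) * exp (-β * V q) := by
    intro q hq
    obtain ⟨h1, h2⟩ := hVM q hq
    rw [← exp_add, exp_le_exp, one_le_exp_iff]
    constructor <;> nlinarith
  have hmeas : Measurable fun x : Xsp d 1 => ENNReal.ofReal (Z⁻¹ * gdens d 1 β V x) := by
    refine (ENNReal.continuous_ofReal.comp ?_).measurable
    unfold gdens
    fun_prop
  refine ⟨ENNReal.ofReal c, ENNReal.ofReal_ne_top, ?_, ?_⟩
  · rw [refMeasure_eq_withDensity, ← withDensity_smul _ (by fun_prop), gibbs]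
    refine withDensity_mono ((ae_mem_cube_volX d 1).mono fun x hx => ?_)
    simp only [Pi.smul_apply, smul_eq_mul]
    rw [← ENNReal.ofReal_mul (by positivity), gdens_eq, hc, ← mul_assoc]
    refine ENNReal.ofReal_le_ofReal ?_
    refine mul_le_mul_of_nonneg_right ?_ (exp_pos _).le
    exact mul_le_mul (le_max_right _ _) (hexp _ hx).1 (exp_pos _).le (by positivity)
  · rw [refMeasure_eq_withDensity, gibbs, ← withDensity_smul _ hmeas]
    refine withDensity_mono ((ae_mem_cube_volX d 1).mono fun x hx => ?_)
    simp only [Pi.smul_apply, smul_eq_mul]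
    rw [← ENNReal.ofReal_mul (by positivity), gdens_eq, hc]
    refine ENNReal.ofReal_le_ofReal ?_
    have h1 : 1 ≤ max Z Z⁻¹ * Z⁻¹ :=
      calc (1 : ℝ) = Z * Z⁻¹ := (mul_inv_cancel₀ hZ.ne').symm
        _ ≤ _ := by gcongr; exact le_max_left _ _
    have h2 := one_le_mul_of_one_le_of_one_le h1 (hexp _ hx).2
    calc _ ≤ max Z Z⁻¹ * Z⁻¹ * (exp (β * M) * exp (-β * V x.1))
          * exp (-(β / 2) * kin d 1 x.2) := le_mul_of_one_le_left (exp_pos _).le h2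
      _ = _ := by ring

lemma exists_poincare_gibbs (d : ℕ) {β : ℝ} (hβ : 0 < β) {V : (Fin d → ℝ) → ℝ}
    (hV : Continuous V) {Z : ℝ} (hZ : 0 < Z) :
    ∃ C : ENNReal, C ≠ ⊤ ∧ ∀ h : Xsp d 1 → ℝ, ContDiff ℝ 1 h →
      ∫⁻ x, ∫⁻ y, ENNReal.ofReal ((h x - h y) ^ 2) ∂(gibbs d 1 β Z V) ∂(gibbs d 1 β Z V)
        ≤ C * ∫⁻ x, ENNReal.ofReal (dirichletP d h x) ∂(gibbs d 1 β Z V) := by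
  obtain ⟨C, hC, hle, hge⟩ := exists_gibbs_le_le d hβ hV hZ
  obtain ⟨K, hK, hP⟩ := exists_poincare_refMeasure d hβ
  refine ⟨C * C * K * C * 3, by finiteness, fun h hh => ?_⟩
  set μ := gibbs d 1 β Z V
  set ν := refMeasure d β
  calc ∫⁻ x, ∫⁻ y, ENNReal.ofReal ((h x - h y) ^ 2) ∂μ ∂μ
      ≤ ∫⁻ x, ∫⁻ y, ENNReal.ofReal ((h x - h y) ^ 2) ∂(C • ν) ∂(C • ν) :=
        lintegral_mono' hle fun x => lintegral_mono' hle le_rfl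
    _ = C * C * ∫⁻ x, ∫⁻ y, ENNReal.ofReal ((h x - h y) ^ 2) ∂ν ∂ν := by
        simp only [lintegral_smul_measure, smul_eq_mul]
        rw [lintegral_const_mul' _ _ hC, mul_assoc]
    _ ≤ C * C * (K * ∫⁻ x, ENNReal.ofReal (gradSq d h x) ∂ν) := by
        gcongr
        exact hP h hh
    _ ≤ C * C * (K * ∫⁻ x, 3 * ENNReal.ofReal (dirichletP d h x) ∂(C • μ)) := by
        gcongr C * C * (K * ?_)
        refine lintegral_mono' hge fun x => ?_
        rw [← ENNReal.ofReal_ofNat, ← ENNReal.ofReal_mul zero_le_three]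
        exact ENNReal.ofReal_le_ofReal (gradSq_le d h x)
    _ = _ := by
        rw [lintegral_smul_measure, lintegral_const_mul' _ _ (by finiteness), smul_eq_mul]
        ring

lemma ofReal_integral_sq_sub_integral_le {Ω : Type*} [MeasurableSpace Ω] (μ : Measure Ω)
    [IsProbabilityMeasure μ] {h : Ω → ℝ} (hh : MemLp h 2 μ) :
    ENNReal.ofReal (∫ x, (h x - ∫ y, h y ∂μ) ^ 2 ∂μ)
      ≤ ∫⁻ x, ∫⁻ y, ENNReal.ofReal ((h x - h y) ^ 2) ∂μ ∂μ := by
  have hi : Integrable h μ := hh.integrable one_le_two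
  have hmem : ∀ c : ℝ, MemLp (fun y => c - h y) 2 μ := fun c => (memLp_const c).sub hh
  have hcen : MemLp (fun x => h x - ∫ y, h y ∂μ) 2 μ := hh.sub (memLp_const _)
  rw [ofReal_integral_eq_lintegral_ofReal hcen.integrable_sq
    (ae_of_all _ fun x => sq_nonneg _)]
  refine lintegral_mono fun x => ?_
  rw [← ofReal_integral_eq_lintegral_ofReal (hmem (h x)).integrable_sq
    (ae_of_all _ fun y => sq_nonneg _)]
  refine ENNReal.ofReal_le_ofReal ?_
  have hvar := ProbabilityTheory.variance_nonneg (fun y => h x - h y) μ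
  rw [ProbabilityTheory.variance_eq_sub (hmem (h x)), integral_sub (integrable_const _) hi,
    integral_const, probReal_univ, one_smul] at hvar
  simpa using hvar

lemma exists_bound_of_support {d m : ℕ} {g : Xsp d m → ℝ} (hg : Continuous g)
    {K : Set ((Fin d → ℝ) × (Fin m → Fin d → ℝ))} (hK : IsCompact K)
    (hgK : ∀ x : Xsp d m, x.2 ∉ K → g x = 0) :
    ∃ M : ℝ, ∀ x : Xsp d m, x.1 ∈ cube d → ‖g x‖ ≤ M := by
  obtain ⟨M, hM⟩ := ((isCompact_Icc (a := (0 : Fin d → ℝ)) (b := 1)).prod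
    hK).exists_bound_of_continuousOn (f := g) hg.continuousOn
  refine ⟨max M 0, fun x hx => ?_⟩
  by_cases hxK : x.2 ∈ K
  · exact (hM x ⟨cube_subset_Icc d hx, hxK⟩).trans (le_max_left _ _)
  · simp [hgK x hxK]

lemma fderiv_eq_zero_of_notMem {d m : ℕ} {h : Xsp d m → ℝ}
    {K : Set ((Fin d → ℝ) × (Fin m → Fin d → ℝ))} (hK : IsCompact K)
    (hhK : ∀ x : Xsp d m, x.2 ∉ K → h x = 0) {x : Xsp d m} (hx : x.2 ∉ K) :
    fderiv ℝ h x = 0 := by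
  have hev : h =ᶠ[nhds x] fun _ => 0 :=
    Filter.mem_of_superset
      ((hK.isClosed.isOpen_compl.preimage continuous_snd).mem_nhds hx) hhK
  rw [hev.fderiv_eq, fderiv_fun_const, Pi.zero_apply]

/-- (Coercivity of `P = A*A + C*C + C₂*C₂`, case `m = 1`.)
Assume `V ∈ C²(𝕋^d)`. Then there is `κ > 0` such that for every test function `h`,
`∫ (|∇_z h|² + |∇_p h|² + |∇_z h − ∇_q h|²) dμ_β ≥ κ ∫ (h − ∫ h dμ_β)² dμ_β`. -/
theorem coercivity_P
    (d : ℕ) (hd : 1 ≤ d)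
    (β : ℝ) (hβ : 0 < β)
    (α lam : Fin 1 → ℝ) (hα : ∀ j, 0 < α j) (hlam : ∀ j, 0 < lam j)
    (V : (Fin d → ℝ) → ℝ) (hV : ContDiff ℝ 2 V) (hVper : PerV d V)
    (Z : ℝ) (hZ : 0 < Z)
    (hprob : IsProbabilityMeasure (gibbs d 1 β Z V)) :
    ∃ κ : ℝ, 0 < κ ∧ ∀ h : Xsp d 1 → ℝ, IsTest d 1 h →
      κ * ∫ x, (h x - ∫ y, h y ∂(gibbs d 1 β Z V)) ^ 2 ∂(gibbs d 1 β Z V)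
        ≤ ∫ x, (∑ k, (pZ d 1 0 k h x) ^ 2 + ∑ k, (pP d 1 k h x) ^ 2
            + ∑ k, (pZ d 1 0 k h x - pQ d 1 k h x) ^ 2) ∂(gibbs d 1 β Z V) := by
  obtain ⟨C, hC, hP⟩ := exists_poincare_gibbs d hβ hV.continuous hZ
  set μ := gibbs d 1 β Z V
  have hcube : ∀ᵐ x ∂μ, x.1 ∈ cube d := ae_mem_cube_gibbs d 1 β Z V
  refine ⟨(C.toReal + 1)⁻¹, by positivity, fun h hh => ?_⟩
  obtain ⟨hsmooth, -, K, hK, hhK⟩ := hh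
  have hC1 : ContDiff ℝ 1 h := hsmooth.of_le (by exact_mod_cast le_top)
  have hmem : MemLp h 2 μ := by
    obtain ⟨M, hM⟩ := exists_bound_of_support hC1.continuous hK hhK
    exact MemLp.of_bound hC1.continuous.aestronglyMeasurable M (hcube.mono hM)
  have hint : Integrable (dirichletP d h) μ := by
    have hc := continuous_dirichletP hC1
    obtain ⟨M, hM⟩ := exists_bound_of_support hc hK fun x hx => by
      simp [dirichletP, pZ, pP, pQ, fderiv_eq_zero_of_notMem hK hhK hx]
    exact Integrable.of_bound hc.aestronglyMeasurable M (hcube.mono hM)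
  have hnonneg : ∀ x, 0 ≤ dirichletP d h x := fun x => by
    unfold dirichletP
    positivity
  have hI : 0 ≤ ∫ x, dirichletP d h x ∂μ := integral_nonneg hnonneg
  have hmain := (ofReal_integral_sq_sub_integral_le μ hmem).trans (hP h hC1)
  rw [← ofReal_integral_eq_lintegral_ofReal hint (ae_of_all _ hnonneg), ← ENNReal.ofReal_toReal hC,
    ← ENNReal.ofReal_mul ENNReal.toReal_nonneg,
    ENNReal.ofReal_le_ofReal_iff (mul_nonneg ENNReal.toReal_nonneg hI)] at hmain
  rw [inv_mul_le_iff₀ (by positivity)]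
  refine hmain.trans ?_
  exact mul_le_mul_of_nonneg_right (le_add_of_nonneg_right zero_le_one) hI
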